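/- Let K be an imaginary quadratic field, O an order in K of discriminant D_O, and N a positive integer. The map Q ↦ ℤω_Q + ℤ induces a well-defined bijection φ_{O,N} : C_N(D_O) → C_N(O), [Q] ↦ [ℤω_Q + ℤ]; that is: (well-definedness) if Q, Q' ∈ Q(D_O,N) lie in the same Γ₁(N)-orbit then the fractional ideals ℤω_Q + ℤ and ℤω_{Q'} + ℤ define the same class in C_N(O); (injectivity) if ℤω_Q + ℤ and ℤω_{Q'} + ℤ define the same class in C_N(O) then Q and Q' lie in the same Γ₁(N)-orbit; (surjectivity) every class in C_N(O) is of the form [ℤω_Q + ℤ] for some Q ∈ Q(D_O,N). -/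

import Mathlib

open scoped nonZeroDivisors

set_option synthInstance.maxHeartbeats 1000000
set_option maxHeartbeats 1000000

noncomputable section

/-- `√D := i√|D|` for a negative integer `D`. -/
def sqrtD (D : ℤ) : ℂ := Complex.I * Real.sqrt (Int.natAbs D)

/-- `τ_O`: `√D/2` if `D ≡ 0 (mod 4)`, and `(-1+√D)/2` if `D ≡ 1 (mod 4)`. -/
def tauD (D : ℤ) : ℂ := if D % 4 = 0 then sqrtD D / 2 else (-1 + sqrtD D) / 2

/-- The order `O = ℤτ_O + ℤ = ℤ[τ_O]` of discriminant `D` in the imaginary quadratic field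
`K = ℚ(√D) ⊆ ℂ`. -/
def OD (D : ℤ) : Subalgebra ℤ ℂ := Algebra.adjoin ℤ {tauD D}

/-- Fractional `O`-ideals (inside `ℂ ⊇ K`; every fractional `O`-ideal lies in `K`). -/
abbrev Frac (O : Subalgebra ℤ ℂ) := FractionalIdeal ((O : Type))⁰ ℂ

/-- A nonzero ideal `a` of `O` is *prime to* `m` if `a + mO = O`. -/
def primeTo (O : Subalgebra ℤ ℂ) (m : ℕ) (a : Ideal O) : Prop :=
  a ⊔ Ideal.span {(m : (O : Type))} = ⊤

/-- `M(O, m)`: the nonzero proper (equivalently, invertible) `O`-ideals prime to `m`. -/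
def Mset (O : Subalgebra ℤ ℂ) (m : ℕ) : Set (Ideal O) :=
  {a | a ≠ 0 ∧ primeTo O m a ∧ IsUnit (a : Frac O)}

/-- `I(O, m)`: the subgroup of invertible fractional `O`-ideals generated by `M(O, m)`. -/
def Igrp (O : Subalgebra ℤ ℂ) (m : ℕ) : Subgroup (Frac O)ˣ :=
  Subgroup.closure {u | ∃ a ∈ Mset O m, (u : Frac O) = a}

/-- `P_N(O)`: the subgroup generated by the principal ideals `νO` with `ν ∈ O` nonzero and
`ν ≡ 1 (mod NO)`. -/
def Pgrp (O : Subalgebra ℤ ℂ) (N : ℕ) : Subgroup (Frac O)ˣ :=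
  Subgroup.closure {u | ∃ ν : (O : Type), ν ≠ 0 ∧
    (∃ μ : (O : Type), ν = 1 + (N : (O : Type)) * μ) ∧
    (u : Frac O) = ((Ideal.span {ν} : Ideal O) : Frac O)}

/-- The ray class group `C_N(O) = I(O, N)/P_N(O)`. -/
abbrev ClsGrp (O : Subalgebra ℤ ℂ) (N : ℕ) :=
  (Igrp O N) ⧸ ((Pgrp O N).subgroupOf (Igrp O N))

/-- The underlying set (in `ℂ`) of an invertible fractional ideal. -/
def fracSet {O : Subalgebra ℤ ℂ} (u : (Frac O)ˣ) : Set ℂ :=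
  (((u : Frac O) : Submodule (O : Type) ℂ) : Set ℂ)

/-- An integral binary quadratic form `a x² + b x y + c y²`. -/
structure QF where
  a : ℤ
  b : ℤ
  c : ℤ

/-- The discriminant `b² - 4ac`. -/
def QF.disc (Q : QF) : ℤ := Q.b ^ 2 - 4 * Q.a * Q.c

/-- `Q ∈ 𝒬(D)`: primitive positive definite of discriminant `D`. -/
def IsForm (D : ℤ) (Q : QF) : Prop :=
  Int.gcd Q.a (Int.gcd Q.b Q.c) = 1 ∧ Q.disc = D ∧ 0 < Q.a

/-- `Q ∈ 𝒬(D, N)`: additionally `gcd(a, N) = 1`. -/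
def IsFormN (D : ℤ) (N : ℕ) (Q : QF) : Prop := IsForm D Q ∧ Int.gcd Q.a N = 1

/-- `ω_Q = (-b + √D)/(2a)`, the root of `Q(x, 1)` in the upper half-plane. -/
def omegaQ (D : ℤ) (Q : QF) : ℂ := (-(Q.b : ℂ) + sqrtD D) / (2 * Q.a)

/-- The lattice `ℤω + ℤ`, as a subset of `ℂ`. -/
def latticeSet (ω : ℂ) : Set ℂ := {z : ℂ | ∃ m n : ℤ, z = (m : ℂ) * ω + (n : ℂ)}

/-- The right action `Q^γ(x,y) = Q(px + qy, rx + sy)` on coefficients. -/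
def QF.act (Q : QF) (γ : Matrix (Fin 2) (Fin 2) ℤ) : QF :=
  ⟨Q.a * (γ 0 0) ^ 2 + Q.b * (γ 0 0) * (γ 1 0) + Q.c * (γ 1 0) ^ 2,
   2 * Q.a * (γ 0 0) * (γ 0 1) + Q.b * ((γ 0 0) * (γ 1 1) + (γ 0 1) * (γ 1 0))
     + 2 * Q.c * (γ 1 0) * (γ 1 1),
   Q.a * (γ 0 1) ^ 2 + Q.b * (γ 0 1) * (γ 1 1) + Q.c * (γ 1 1) ^ 2⟩

abbrev SL2Z := Matrix.SpecialLinearGroup (Fin 2) ℤ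

/-- `γ ∈ Γ₁(N)`, i.e. `γ ≡ (1 *; 0 1) (mod N)`. -/
def InGamma1 (N : ℕ) (γ : SL2Z) : Prop :=
  (N : ℤ) ∣ ((γ : Matrix (Fin 2) (Fin 2) ℤ) 0 0 - 1) ∧
  (N : ℤ) ∣ ((γ : Matrix (Fin 2) (Fin 2) ℤ) 1 0) ∧
  (N : ℤ) ∣ ((γ : Matrix (Fin 2) (Fin 2) ℤ) 1 1 - 1)

/-- Proper equivalence of forms under `Γ₁(N)`. -/
def EquivG1 (N : ℕ) (Q Q' : QF) : Prop :=
  ∃ γ : SL2Z, InGamma1 N γ ∧ Q.act (γ : Matrix (Fin 2) (Fin 2) ℤ) = Q'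

/-- The form class set `C_N(D) = 𝒬(D, N)/∼_{Γ₁(N)}`. -/
abbrev CForm (D : ℤ) (N : ℕ) :=
  Quot (fun Q Q' : {Q : QF // IsFormN D N Q} => EquivG1 N Q.1 Q'.1)

section gen
variable {O : Subalgebra ℤ ℂ}

lemma fr_mem_fracSet (u : (Frac O)ˣ) (z : ℂ) : z ∈ fracSet u ↔ z ∈ (u : Frac O) := Iff.rfl

lemma fr_ext {u v : (Frac O)ˣ} (h : fracSet u = fracSet v) : u = v := by
  apply Units.ext
  apply FractionalIdeal.ext
  intro x
  exact Set.ext_iff.mp h x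

lemma fr_smul (u : Frac O) {x z : ℂ} (hx : x ∈ O) (hz : z ∈ u) : x * z ∈ u := by
  have := (u : Submodule O ℂ).smul_mem (⟨x, hx⟩ : O) hz
  exact this

lemma fr_mem_one {x : ℂ} : x ∈ (1 : Frac O) ↔ x ∈ O := by
  rw [FractionalIdeal.mem_one_iff]
  constructor
  · rintro ⟨y, rfl⟩; exact y.2
  · intro h; exact ⟨⟨x, h⟩, rfl⟩

lemma fr_proper (u : (Frac O)ˣ) (x : ℂ) (h : ∀ z ∈ fracSet u, x * z ∈ fracSet u) : x ∈ O := by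
  have h1 : (1 : ℂ) ∈ (u : Frac O) * ((u⁻¹ : (Frac O)ˣ) : Frac O) := by
    rw [Units.mul_inv]; exact fr_mem_one.2 O.one_mem
  have key : ∀ r ∈ (u : Frac O) * ((u⁻¹ : (Frac O)ˣ) : Frac O),
      x * r ∈ (u : Frac O) * ((u⁻¹ : (Frac O)ˣ) : Frac O) := by
    intro r hr
    refine FractionalIdeal.mul_induction_on hr ?_ ?_
    · intro i hi j hj
      rw [← mul_assoc]
      exact FractionalIdeal.mul_mem_mul (h i hi) hj
    · intro a b ha hb
      rw [mul_add]
      exact Submodule.add_mem _ ha hb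
  have := key 1 h1
  rw [Units.mul_inv, mul_one] at this
  exact fr_mem_one.1 this

lemma fr_inj {ν : O} (hν : ν ≠ 0) : (ν : ℂ) ≠ 0 := by
  simpa using hν

lemma fr_mem_span {ν : O} {z : ℂ} :
    z ∈ ((Ideal.span {ν} : Ideal O) : Frac O) ↔ ∃ y ∈ O, z = (ν : ℂ) * y := by
  rw [FractionalIdeal.mem_coeIdeal]
  constructor
  · rintro ⟨y, hy, rfl⟩
    obtain ⟨w, rfl⟩ := Ideal.mem_span_singleton.1 hy
    exact ⟨w, w.2, rfl⟩
  · rintro ⟨y, hy, rfl⟩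
    exact ⟨ν * ⟨y, hy⟩, Ideal.mem_span_singleton.2 ⟨_, rfl⟩, rfl⟩

/-- inverse principal ideal -/
def fr_pinv (ν : O) (hν : ν ≠ 0) : Frac O :=
  ⟨Submodule.span O {((ν : ℂ))⁻¹}, ν, mem_nonZeroDivisors_of_ne_zero hν, by
    intro b hb
    obtain ⟨c, rfl⟩ := Submodule.mem_span_singleton.1 hb
    refine ⟨c, ?_⟩
    have := fr_inj hν
    change (c : ℂ) = (ν : ℂ) * ((c : ℂ) * (ν : ℂ)⁻¹)
    field_simp⟩

lemma fr_mem_pinv (ν : O) (hν : ν ≠ 0) (z : ℂ) : z ∈ fr_pinv ν hν ↔ (ν : ℂ) * z ∈ O := by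
  have h0 := fr_inj hν
  have : z ∈ fr_pinv ν hν ↔ z ∈ Submodule.span O {((ν : ℂ))⁻¹} := Iff.rfl
  rw [this, Submodule.mem_span_singleton]
  constructor
  · rintro ⟨c, rfl⟩
    have : (ν : ℂ) * (c • ((ν : ℂ))⁻¹) = c := by
      change (ν : ℂ) * ((c : ℂ) * (ν : ℂ)⁻¹) = c
      field_simp
    rw [this]; exact c.2
  · intro h
    refine ⟨⟨_, h⟩, ?_⟩
    change (ν : ℂ) * z * (ν : ℂ)⁻¹ = z
    field_simp

lemma fr_mul_pinv (ν : O) (hν : ν ≠ 0) :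
    ((Ideal.span {ν} : Ideal O) : Frac O) * fr_pinv ν hν = 1 := by
  have h0 := fr_inj hν
  apply le_antisymm
  · rw [FractionalIdeal.mul_le]
    intro i hi j hj
    obtain ⟨y, hy, rfl⟩ := fr_mem_span.1 hi
    rw [fr_mem_pinv] at hj
    rw [fr_mem_one]
    have : (ν : ℂ) * y * j = y * (ν * j) := by ring
    rw [this]
    exact O.mul_mem hy hj
  · intro x hx
    have hx := fr_mem_one.1 hx
    have : x = (ν : ℂ) * 1 * (x * (ν : ℂ)⁻¹) := by field_simp
    rw [this]
    refine FractionalIdeal.mul_mem_mul (fr_mem_span.2 ⟨1, O.one_mem, rfl⟩) ?_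
    rw [fr_mem_pinv]
    have : (ν : ℂ) * (x * (ν : ℂ)⁻¹) = x := by field_simp
    rwa [this]

/-- principal unit -/
def pu (ν : O) (hν : ν ≠ 0) : (Frac O)ˣ :=
  ⟨((Ideal.span {ν} : Ideal O) : Frac O), fr_pinv ν hν, fr_mul_pinv ν hν, by
    rw [mul_comm]; exact fr_mul_pinv ν hν⟩

lemma pu_val (ν : O) (hν : ν ≠ 0) : (pu ν hν : Frac O) = ((Ideal.span {ν} : Ideal O) : Frac O) := rfl

lemma pu_mul_mem (ν : O) (hν : ν ≠ 0) (u : (Frac O)ˣ) (z : ℂ) :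
    z ∈ fracSet (pu ν hν * u) ↔ ∃ y ∈ fracSet u, z = (ν : ℂ) * y := by
  have h0 := fr_inj hν
  rw [fr_mem_fracSet, Units.val_mul, pu_val]
  constructor
  · intro hz
    refine FractionalIdeal.mul_induction_on hz ?_ ?_
    · intro i hi j hj
      obtain ⟨y, hy, rfl⟩ := fr_mem_span.1 hi
      exact ⟨y * j, fr_smul _ hy hj, by ring⟩
    · intro a b ha hb
      change ∃ y ∈ fracSet u, a = (ν : ℂ) * y at ha
      change ∃ y ∈ fracSet u, b = (ν : ℂ) * y at hb
      obtain ⟨x, hx, rfl⟩ := ha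
      obtain ⟨y, hy, rfl⟩ := hb
      exact ⟨x + y, Submodule.add_mem _ hx hy, by ring⟩
  · rintro ⟨y, hy, rfl⟩
    exact FractionalIdeal.mul_mem_mul (fr_mem_span.2 ⟨1, O.one_mem, by ring⟩) hy

lemma pu_inv_mul_mem (ν : O) (hν : ν ≠ 0) (u : (Frac O)ˣ) (z : ℂ) :
    z ∈ fracSet ((pu ν hν)⁻¹ * u) ↔ (ν : ℂ) * z ∈ fracSet u := by
  have h0 := fr_inj hν
  have h := pu_mul_mem ν hν ((pu ν hν)⁻¹ * u) ((ν : ℂ) * z)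
  rw [mul_inv_cancel_left] at h
  rw [h]
  constructor
  · intro hz; exact ⟨z, hz, rfl⟩
  · rintro ⟨y, hy, hzy⟩
    rwa [mul_left_cancel₀ h0 hzy]

lemma pu_mul (ν μ : O) (hν : ν ≠ 0) (hμ : μ ≠ 0) :
    pu (ν * μ) (mul_ne_zero hν hμ) = pu ν hν * pu μ hμ := by
  apply Units.ext
  rw [Units.val_mul, pu_val, pu_val, pu_val, ← FractionalIdeal.coeIdeal_mul,
    Ideal.span_singleton_mul_span_singleton]

/-- congruent to one mod N -/
def cong1 (N : ℕ) (ν : O) : Prop := ∃ μ : O, ν = 1 + (N : O) * μ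

lemma cong1_mul {N : ℕ} {ν μ : O} (h : cong1 N ν) (h' : cong1 N μ) : cong1 N (ν * μ) := by
  obtain ⟨a, rfl⟩ := h
  obtain ⟨b, rfl⟩ := h'
  exact ⟨a + b + N * a * b, by ring⟩

lemma pu_mem_P {N : ℕ} {ν : O} (hν : ν ≠ 0) (h : cong1 N ν) : pu ν hν ∈ Pgrp O N :=
  Subgroup.subset_closure ⟨ν, hν, h, rfl⟩

lemma P_elim {N : ℕ} {x : (Frac O)ˣ} (hx : x ∈ Pgrp O N) :
    ∃ (ν μ : O) (hν : ν ≠ 0) (hμ : μ ≠ 0), cong1 N ν ∧ cong1 N μ ∧ x * pu μ hμ = pu ν hν := by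
  have h1 : cong1 N (1 : O) := ⟨0, by ring⟩
  induction hx using Subgroup.closure_induction with
  | mem x hx =>
    obtain ⟨ν, hν, hc, hx⟩ := hx
    have : x = pu ν hν := Units.ext hx
    subst this
    refine ⟨ν, 1, hν, one_ne_zero, hc, h1, ?_⟩
    rw [← pu_mul]; congr 1; rw [mul_one]
  | one => exact ⟨1, 1, one_ne_zero, one_ne_zero, h1, h1, one_mul _⟩
  | mul x y _ _ hx hy =>
    obtain ⟨a, b, ha, hb, ca, cb, h⟩ := hx
    obtain ⟨c, d, hc, hd, cc, cd, h'⟩ := hy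
    refine ⟨a * c, b * d, mul_ne_zero ha hc, mul_ne_zero hb hd, cong1_mul ca cc,
      cong1_mul cb cd, ?_⟩
    rw [pu_mul _ _ ha hc, pu_mul _ _ hb hd, ← h, ← h']
    exact mul_mul_mul_comm _ _ _ _
  | inv x _ hx =>
    obtain ⟨a, b, ha, hb, ca, cb, h⟩ := hx
    exact ⟨b, a, hb, ha, cb, ca, by rw [← h, inv_mul_cancel_left]⟩

lemma span_mem_M {N : ℕ} {ν : O} (hν : ν ≠ 0) (h : primeTo O N (Ideal.span {ν})) :
    Ideal.span {ν} ∈ Mset O N :=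
  ⟨by simpa using hν, h, ⟨pu ν hν, rfl⟩⟩

lemma cong1_primeTo {N : ℕ} {ν : O} (h : cong1 N ν) {A : Ideal O} (hA : ν ∈ A) :
    primeTo O N A := by
  obtain ⟨μ, rfl⟩ := h
  unfold primeTo
  rw [Ideal.eq_top_iff_one]
  have : (1 : O) = (1 + N * μ) + N * (-μ) := by ring
  rw [this]
  exact Submodule.add_mem_sup hA (Ideal.mem_span_singleton.2 ⟨_, rfl⟩)

lemma M_mem_I {N : ℕ} {A : Ideal O} (hA : A ∈ Mset O N) (u : (Frac O)ˣ) (hu : (u : Frac O) = A) :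
    u ∈ Igrp O N := Subgroup.subset_closure ⟨A, hA, hu⟩

lemma P_le_I {N : ℕ} : Pgrp O N ≤ Igrp O N := by
  unfold Pgrp
  rw [Subgroup.closure_le]
  rintro u ⟨ν, hν, hc, hu⟩
  exact M_mem_I (span_mem_M hν (cong1_primeTo hc (Ideal.mem_span_singleton_self ν))) u hu

lemma exists_cong1 {N : ℕ} (hN : 0 < N) {A : Ideal O} (hA : A ∈ Mset O N) :
    ∃ ν ∈ A, ν ≠ 0 ∧ cong1 N ν := by
  obtain ⟨h0, hp, -⟩ := hA
  have h1 : (1 : O) ∈ A ⊔ Ideal.span {(N : O)} := by rw [hp]; trivial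
  obtain ⟨β, hβ, γ, hγ, h⟩ := Submodule.mem_sup.1 h1
  obtain ⟨μ, rfl⟩ := Ideal.mem_span_singleton.1 hγ
  by_cases hz : β = 0
  · obtain ⟨β', hb, hb0⟩ := Submodule.exists_mem_ne_zero_of_ne_bot h0
    refine ⟨N * β', A.mul_mem_left _ hb, mul_ne_zero ?_ hb0, ⟨β' - μ, ?_⟩⟩
    · intro hh
      rw [hz, hh] at h
      simp at h
    · rw [hz] at h
      linear_combination h
  · exact ⟨β, hβ, hz, ⟨-μ, by linear_combination h⟩⟩

lemma M_mul {N : ℕ} (hN : 0 < N) {A B : Ideal O} (hA : A ∈ Mset O N) (hB : B ∈ Mset O N) :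
    A * B ∈ Mset O N := by
  obtain ⟨ν, hν, hν0, cν⟩ := exists_cong1 hN hA
  obtain ⟨μ, hμ, hμ0, cμ⟩ := exists_cong1 hN hB
  have hm : ν * μ ∈ A * B := Ideal.mul_mem_mul hν hμ
  refine ⟨?_, cong1_primeTo (cong1_mul cν cμ) hm, ?_⟩
  · intro h
    rw [h] at hm
    exact mul_ne_zero hν0 hμ0 hm
  · rw [FractionalIdeal.coeIdeal_mul]
    exact hA.2.2.mul hB.2.2

lemma I_elim {N : ℕ} (hN : 0 < N) {u : (Frac O)ˣ} (hu : u ∈ Igrp O N) :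
    ∃ A ∈ Mset O N, ∃ v : (Frac O)ˣ, (v : Frac O) = A ∧ u⁻¹ * v ∈ Pgrp O N := by
  induction hu using Subgroup.closure_induction with
  | mem x hx =>
    obtain ⟨A, hA, h⟩ := hx
    exact ⟨A, hA, x, h, by rw [inv_mul_cancel]; exact one_mem _⟩
  | one =>
    refine ⟨⊤, ⟨?_, cong1_primeTo (ν := 1) ⟨0, by ring⟩ trivial, ?_⟩, 1, ?_, ?_⟩
    · intro h
      exact one_ne_zero (α := O) ((Submodule.eq_bot_iff _).1 h 1 trivial)
    · rw [FractionalIdeal.coeIdeal_top]; exact isUnit_one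
    · rw [FractionalIdeal.coeIdeal_top]; rfl
    · simp
  | mul x y _ _ hx hy =>
    obtain ⟨A, hA, a, ha, h⟩ := hx
    obtain ⟨B, hB, b, hb, h'⟩ := hy
    refine ⟨A * B, M_mul hN hA hB, a * b, ?_, ?_⟩
    · rw [Units.val_mul, ha, hb, FractionalIdeal.coeIdeal_mul]
    · have : (x * y)⁻¹ * (a * b) = (x⁻¹ * a) * (y⁻¹ * b) := by
        rw [mul_inv]; exact mul_mul_mul_comm _ _ _ _
      rw [this]
      exact mul_mem h h'
  | inv x _ hx =>
    obtain ⟨A, hA, a, ha, h⟩ := hx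
    obtain ⟨ν, hν, hν0, cν⟩ := exists_cong1 hN hA
    have hle : ((a⁻¹ * pu ν hν0 : (Frac O)ˣ) : Frac O) ≤ 1 := by
      rw [Units.val_mul, pu_val, ← Units.inv_mul a]
      refine mul_le_mul' le_rfl ?_
      rw [ha]
      intro z hz
      obtain ⟨y, hy, rfl⟩ := fr_mem_span.1 hz
      rw [mul_comm]
      exact fr_smul _ hy (FractionalIdeal.mem_coeIdeal_of_mem _ hν)
    obtain ⟨C, hC⟩ := FractionalIdeal.le_one_iff_exists_coeIdeal.1 hle
    have hνC : ν ∈ C := by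
      have h1 : (ν : ℂ) ∈ (C : Frac O) := by
        rw [hC, ← fr_mem_fracSet, mul_comm, pu_mul_mem]
        refine ⟨1, ?_, by ring⟩
        rw [fr_mem_fracSet]
        have : (1 : Frac O) ≤ ((a⁻¹ : (Frac O)ˣ) : Frac O) := by
          rw [← Units.inv_mul a]
          calc _ ≤ ((a⁻¹ : (Frac O)ˣ) : Frac O) * 1 := by
                refine mul_le_mul' le_rfl ?_
                rw [ha]; exact FractionalIdeal.coeIdeal_le_one
            _ = _ := mul_one _
        exact this (fr_mem_one.2 O.one_mem)
      obtain ⟨y, hy, hyv⟩ := (FractionalIdeal.mem_coeIdeal _).1 h1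
      have : y = ν := Subtype.ext hyv
      rwa [← this]
    refine ⟨C, ⟨?_, cong1_primeTo cν hνC, ⟨_, hC.symm⟩⟩, _, hC.symm, ?_⟩
    · intro h0
      rw [h0] at hνC
      exact hν0 hνC
    · have : (x⁻¹)⁻¹ * (a⁻¹ * pu ν hν0) = (x⁻¹ * a)⁻¹ * pu ν hν0 := by
        rw [mul_inv, inv_inv, mul_assoc]
      rw [this]
      exact mul_mem (inv_mem h) (pu_mem_P _ cν)

end gen
section quad
variable {D : ℤ}

lemma sqrtD_sq (hD : D < 0) : sqrtD D ^ 2 = (D : ℂ) := by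
  unfold sqrtD
  rw [mul_pow, Complex.I_sq, ← Complex.ofReal_pow, Real.sq_sqrt (by positivity)]
  have : ((D.natAbs : ℤ)) = -D := by omega
  have h2 : ((D.natAbs : ℝ)) = -(D : ℝ) := by
    rw [← Int.cast_natCast, this]; push_cast; ring
  rw [h2]; push_cast; ring

lemma sqrtD_im (hD : D < 0) : 0 < (sqrtD D).im := by
  unfold sqrtD
  simp [Complex.mul_im]
  omega

lemma tau_spec (hD4 : D % 4 = 0 ∨ D % 4 = 1) :
    ∃ t e : ℤ, 2 * tauD D = t + sqrtD D ∧ D = t ^ 2 + 4 * e := by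
  unfold tauD
  rcases hD4 with h | h
  · refine ⟨0, D / 4, ?_, by omega⟩
    rw [if_pos h]; push_cast; ring
  · refine ⟨-1, D / 4, ?_, by omega⟩
    rw [if_neg (by omega)]; push_cast; ring

lemma tau_sq (hD : D < 0) {t e : ℤ} (h1 : 2 * tauD D = t + sqrtD D) (h2 : D = t ^ 2 + 4 * e) :
    tauD D ^ 2 = t * tauD D + e := by
  have h3 := sqrtD_sq hD
  have h4 : (D : ℂ) = (t : ℂ) ^ 2 + 4 * e := by exact_mod_cast h2
  have h5 : sqrtD D = 2 * tauD D - t := by rw [h1]; ring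
  rw [h5, h4] at h3
  linear_combination h3 / 4

lemma tau_im (hD : D < 0) {t : ℤ} (h1 : 2 * tauD D = t + sqrtD D) : 0 < (tauD D).im := by
  have := sqrtD_im hD
  have h := congrArg Complex.im h1
  simp at h
  linarith

lemma indep {ω : ℂ} (h : ω.im ≠ 0) {m n m' n' : ℤ}
    (he : (m : ℂ) * ω + n = (m' : ℂ) * ω + n') : m = m' ∧ n = n' := by
  have h1 := congrArg Complex.im he
  simp [h] at h1
  subst h1
  simpa using he

lemma mem_OD (hD : D < 0) (hD4 : D % 4 = 0 ∨ D % 4 = 1) {x : ℂ} :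
    x ∈ OD D ↔ ∃ m n : ℤ, x = (m : ℂ) * tauD D + n := by
  obtain ⟨t, e, h1, h2⟩ := tau_spec hD4
  have h3 := tau_sq hD h1 h2
  constructor
  · intro hx
    unfold OD at hx
    induction hx using Algebra.adjoin_induction with
    | mem x hx => 
      obtain rfl : x = tauD D := hx
      exact ⟨1, 0, by simp⟩
    | algebraMap r => exact ⟨0, r, by simp⟩
    | add x y _ _ hx hy =>
      obtain ⟨m, n, rfl⟩ := hx
      obtain ⟨m', n', rfl⟩ := hy
      exact ⟨m + m', n + n', by push_cast; ring⟩
    | mul x y _ _ hx hy =>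
      obtain ⟨m, n, rfl⟩ := hx
      obtain ⟨m', n', rfl⟩ := hy
      exact ⟨m * m' * t + m * n' + n * m', m * m' * e + n * n', by
        push_cast
        linear_combination (m * m' : ℂ) * h3⟩
  · rintro ⟨m, n, rfl⟩
    have ht : tauD D ∈ OD D := Algebra.subset_adjoin rfl
    exact add_mem (mul_mem (intCast_mem _ _) ht) (intCast_mem _ _)

lemma form_spec (hD : D < 0) {t e : ℤ} (h1 : 2 * tauD D = t + sqrtD D)
    (h2 : D = t ^ 2 + 4 * e) {Q : QF} (hQ : IsForm D Q) :
    0 < (omegaQ D Q).im ∧ (Q.a : ℂ) * omegaQ D Q ^ 2 + Q.b * omegaQ D Q + Q.c = 0 ∧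
    ∃ h : ℤ, (Q.a : ℂ) * omegaQ D Q = tauD D - h := by
  obtain ⟨hg, hd, ha⟩ := hQ
  have ha0 : (Q.a : ℂ) ≠ 0 := by exact_mod_cast ha.ne'
  have e1 : 2 * (Q.a : ℂ) * omegaQ D Q = -Q.b + sqrtD D := by
    unfold omegaQ; field_simp
  have hs := sqrtD_sq hD
  have hd' : (Q.b : ℂ) ^ 2 - 4 * Q.a * Q.c = D := by unfold QF.disc at hd; exact_mod_cast hd
  refine ⟨?_, ?_, ?_⟩
  · have := congrArg Complex.im e1
    simp at this
    have h3 := sqrtD_im hD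
    have haR : (0 : ℝ) < Q.a := by exact_mod_cast ha
    rw [← this] at h3
    exact pos_of_mul_pos_right h3 (by positivity)
  · have e2 : sqrtD D = 2 * (Q.a : ℂ) * omegaQ D Q + Q.b := by rw [e1]; ring
    rw [e2, ← hd'] at hs
    have : (4 * Q.a : ℂ) * ((Q.a : ℂ) * omegaQ D Q ^ 2 + Q.b * omegaQ D Q + Q.c) = 0 := by
      linear_combination hs
    exact (mul_eq_zero.1 this).resolve_left (by simpa using ha0)
  · have hp : (2 : ℤ) ∣ Q.b + t := by
      have h5 : (Q.b + t) * (Q.b - t) = 2 * (2 * (e + Q.a * Q.c)) := by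
        unfold QF.disc at hd
        linear_combination hd + h2
      rcases Int.Prime.dvd_mul' Nat.prime_two ⟨_, h5⟩ with h | h
      · exact h
      · have h : (2 : ℤ) ∣ Q.b - t := h
        omega
    obtain ⟨h, hh⟩ := hp
    refine ⟨h, ?_⟩
    have hh' : (Q.b : ℂ) + t = 2 * h := by exact_mod_cast hh
    linear_combination e1 / 2 - h1 / 2 - hh' / 2

lemma mem_OD' (hD : D < 0) (hD4 : D % 4 = 0 ∨ D % 4 = 1) {Q : QF} (hQ : IsForm D Q) {x : ℂ} :
    x ∈ OD D ↔ ∃ m n : ℤ, x = (m : ℂ) * (Q.a * omegaQ D Q) + n := by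
  obtain ⟨t, e, h1, h2⟩ := tau_spec hD4
  obtain ⟨-, -, h, hh⟩ := form_spec hD h1 h2 hQ
  rw [mem_OD hD hD4, hh]
  constructor
  · rintro ⟨m, n, rfl⟩
    exact ⟨m, n + m * h, by push_cast; ring⟩
  · rintro ⟨m, n, rfl⟩
    exact ⟨m, n - m * h, by push_cast; ring⟩

lemma gcd_comb {a b c : ℤ} (h : Int.gcd a (Int.gcd b c) = 1) :
    ∃ x y z : ℤ, a * x + b * y + c * z = 1 := by
  have h1 := Int.gcd_eq_gcd_ab a (Int.gcd b c)
  have h2 := Int.gcd_eq_gcd_ab b c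
  rw [h] at h1
  refine ⟨Int.gcdA a (Int.gcd b c), Int.gcdA b c * Int.gcdB a (Int.gcd b c),
    Int.gcdB b c * Int.gcdB a (Int.gcd b c), ?_⟩
  push_cast at h1
  linear_combination -h1 - (Int.gcdB a (Int.gcd b c)) * h2

lemma exist_part (hD : D < 0) (hD4 : D % 4 = 0 ∨ D % 4 = 1) (N : ℕ) (Q : QF)
    (hQ : IsFormN D N Q) :
    ∃ u : (Frac (OD D))ˣ, fracSet u = latticeSet (omegaQ D Q) ∧ u ∈ Igrp (OD D) N := by
  obtain ⟨t, e, h1, h2⟩ := tau_spec hD4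
  obtain ⟨him, hq, -⟩ := form_spec hD h1 h2 hQ.1
  have hmem := fun x => mem_OD' hD hD4 hQ.1 (x := x)
  have hth : (Q.a : ℂ) * omegaQ D Q ∈ OD D := (hmem _).2 ⟨1, 0, by simp⟩
  set ω := omegaQ D Q with hω
  let θ : OD D := ⟨(Q.a : ℂ) * ω, hth⟩
  let a : OD D := (Q.a : OD D)
  have hac : (a : ℂ) = Q.a := by simp [a]
  have hθc : (θ : ℂ) = Q.a * ω := rfl
  have ha0 : a ≠ 0 := by
    have : Q.a ≠ 0 := hQ.1.2.2.ne'
    intro h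
    have h' := congrArg (Subtype.val) h
    rw [hac] at h'
    exact this (by exact_mod_cast h')
  let A : Ideal (OD D) := Ideal.span {a, θ}
  let B : Ideal (OD D) := Ideal.span {a, -(Q.b : OD D) - θ}
  have hθθ : θ * (-(Q.b : OD D) - θ) = a * (Q.c : OD D) := by
    apply Subtype.ext
    push_cast
    rw [hac, hθc]
    linear_combination -(Q.a : ℂ) * hq
  have hAB : A * B = Ideal.span {a} := by
    apply le_antisymm
    · simp only [A, B]
      rw [Ideal.span_mul_span', Ideal.span_le]
      rintro x ⟨y, hy, z, hz, rfl⟩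
      simp only [Set.mem_insert_iff, Set.mem_singleton_iff] at hy hz
      rw [SetLike.mem_coe, Ideal.mem_span_singleton]
      rcases hy with rfl | rfl
      · exact dvd_mul_right _ _
      · rcases hz with rfl | rfl
        · exact dvd_mul_left _ _
        · exact ⟨_, hθθ⟩
    · rw [Ideal.span_singleton_le_iff_mem]
      obtain ⟨x, y, z, hxyz⟩ := gcd_comb hQ.1.1
      have hA1 : a ∈ A := Ideal.subset_span (by simp)
      have hA2 : θ ∈ A := Ideal.subset_span (by simp)
      have hB1 : a ∈ B := Ideal.subset_span (by simp)
      have hB2 : -(Q.b : OD D) - θ ∈ B := Ideal.subset_span (by simp)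
      have hz : (Q.a : OD D) * x + Q.b * y + Q.c * z = 1 := by exact_mod_cast hxyz
      have : a = (x : OD D) * (a * a) + (-(y : OD D)) * (θ * a)
          + (-(y : OD D)) * (a * (-(Q.b : OD D) - θ)) + (z : OD D) * (θ * (-(Q.b : OD D) - θ)) := by
        rw [hθθ]
        have ha' : (Q.a : OD D) = a := rfl
        rw [ha'] at hz
        linear_combination -a * hz
      rw [this]
      refine add_mem (add_mem (add_mem ?_ ?_) ?_) ?_ <;> apply Ideal.mul_mem_left <;>
        apply Ideal.mul_mem_mul <;> assumption
  have hABF : (A : Frac (OD D)) * (B : Frac (OD D)) = (pu a ha0 : Frac (OD D)) := by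
    rw [pu_val, ← hAB, FractionalIdeal.coeIdeal_mul]
  have hAu : IsUnit (A : Frac (OD D)) := isUnit_of_mul_isUnit_left (hABF ▸ (pu a ha0).isUnit)
  obtain ⟨v, hv⟩ := hAu
  have hprime : ∀ C : Ideal (OD D), a ∈ C → primeTo (OD D) N C := by
    intro C hC
    have hc := Int.gcd_eq_gcd_ab Q.a N
    rw [hQ.2] at hc
    unfold primeTo
    rw [Ideal.eq_top_iff_one]
    have : (1 : OD D) = ((Q.a.gcdA N : ℤ) : OD D) * a + (N : OD D) * ((Q.a.gcdB N : ℤ) : OD D) := by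
      have h' := congrArg (Int.cast : ℤ → OD D) hc
      push_cast at h'
      simp only [a]
      linear_combination h'
    rw [this]
    exact Submodule.add_mem_sup (C.mul_mem_left _ hC) (Ideal.mem_span_singleton.2 ⟨_, rfl⟩)
  have haA : a ∈ A := Ideal.subset_span (by simp)
  have hθA : θ ∈ A := Ideal.subset_span (by simp)
  have hvI : v ∈ Igrp (OD D) N := by
    refine M_mem_I ⟨?_, hprime A haA, ⟨v, hv⟩⟩ v hv
    intro h
    rw [h] at haA
    exact ha0 haA
  have haI : pu a ha0 ∈ Igrp (OD D) N :=
    M_mem_I (span_mem_M ha0 (hprime _ (Ideal.mem_span_singleton_self a))) _ rfl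
  refine ⟨(pu a ha0)⁻¹ * v, ?_, mul_mem (inv_mem haI) hvI⟩
  have haC : (Q.a : ℂ) ≠ 0 := by rw [← hac]; exact fr_inj ha0
  ext z
  rw [pu_inv_mul_mem, fr_mem_fracSet, hv, FractionalIdeal.mem_coeIdeal, hac]
  constructor
  · rintro ⟨y, hy, hyz⟩
    obtain ⟨p, q, hpq⟩ := Ideal.mem_span_pair.1 hy
    obtain ⟨m, n, hp⟩ := (hmem p).1 p.2
    obtain ⟨m', n', hq'⟩ := (hmem q).1 q.2
    have hy' : (p : ℂ) * a + q * θ = y := by rw [← hpq]; push_cast; rfl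
    have hyz : (y : ℂ) = Q.a * z := hyz
    refine ⟨m * Q.a - m' * Q.b + n', n - m' * Q.c, ?_⟩
    apply mul_left_cancel₀ haC
    rw [← hyz, ← hy', hac, hθc, hp, hq']
    push_cast
    linear_combination (m' * Q.a : ℂ) * hq
  · rintro ⟨m, n, rfl⟩
    refine ⟨m * θ + n * a, add_mem (A.mul_mem_left _ hθA) (A.mul_mem_left _ haA), ?_⟩
    change ((m * θ + n * a : OD D) : ℂ) = _
    push_cast
    rw [hac, hθc]
    ring
end quad
section part3
variable {D : ℤ}

lemma omega_eq {Q : QF} (ha : Q.a ≠ 0) : 2 * (Q.a : ℂ) * omegaQ D Q = -Q.b + sqrtD D := by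
  have ha0 : (Q.a : ℂ) ≠ 0 := by exact_mod_cast ha
  unfold omegaQ; field_simp

lemma QF_mk (p q r s : ℤ) (Q : QF) : Q.act !![p, q; r, s] =
    ⟨Q.a * p ^ 2 + Q.b * p * r + Q.c * r ^ 2,
     2 * Q.a * p * q + Q.b * (p * s + q * r) + 2 * Q.c * r * s,
     Q.a * q ^ 2 + Q.b * q * s + Q.c * s ^ 2⟩ := by
  simp [QF.act]

lemma omega_act (hD : D < 0) (hD4 : D % 4 = 0 ∨ D % 4 = 1) {Q : QF} (hQ : IsForm D Q)
    {p q r s : ℤ} (hdet : p * s - q * r = 1) (ha : (Q.act !![p, q; r, s]).a ≠ 0) :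
    omegaQ D (Q.act !![p, q; r, s]) * (p - r * omegaQ D Q) = s * omegaQ D Q - q := by
  obtain ⟨t, e, h1, h2⟩ := tau_spec hD4
  obtain ⟨him, hq, -⟩ := form_spec hD h1 h2 hQ
  have e1 := omega_eq (D := D) hQ.2.2.ne'
  have e2 := omega_eq (D := D) ha
  have ha' : ((Q.act !![p, q; r, s]).a : ℂ) ≠ 0 := by exact_mod_cast ha
  have hdet' : (p : ℂ) * s - q * r = 1 := by exact_mod_cast hdet
  apply mul_left_cancel₀ (mul_ne_zero two_ne_zero ha')
  rw [← mul_assoc, e2]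
  rw [QF_mk]
  push_cast
  linear_combination (-2 * r : ℂ) * hq - ((2 * Q.a * p + Q.b * r) * omegaQ D Q + p * Q.b + 2 * r * Q.c) * hdet'
    - (p - r * omegaQ D Q) * e1

lemma act_disc {Q : QF} {p q r s : ℤ} (hdet : p * s - q * r = 1) :
    (Q.act !![p, q; r, s]).disc = Q.disc := by
  rw [QF_mk]
  unfold QF.disc
  simp only
  linear_combination (Q.b ^ 2 - 4 * Q.a * Q.c) * (p * s - q * r + 1) * hdet

lemma act_pos (hD : D < 0) {Q : QF} (hQ : IsForm D Q) {p q r s : ℤ} (hdet : p * s - q * r = 1) :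
    0 < (Q.act !![p, q; r, s]).a := by
  obtain ⟨-, hd, ha⟩ := hQ
  rw [QF_mk]
  simp only
  unfold QF.disc at hd
  have h4 : 4 * Q.a * (Q.a * p ^ 2 + Q.b * p * r + Q.c * r ^ 2) =
      (2 * Q.a * p + Q.b * r) ^ 2 + (-D) * r ^ 2 := by
    rw [← hd]; ring
  have : 0 < (2 * Q.a * p + Q.b * r) ^ 2 + (-D) * r ^ 2 := by
    by_cases hr : r = 0
    · subst hr
      have hp : p ≠ 0 := by rintro rfl; simp at hdet
      have : 0 < (2 * Q.a * p) ^ 2 := by positivity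
      nlinarith
    · have : 0 < r ^ 2 := by positivity
      nlinarith [sq_nonneg (2 * Q.a * p + Q.b * r)]
  rw [← h4] at this
  exact pos_of_mul_pos_right this (by positivity)

lemma form_uniq (hD : D < 0) {Q Q' : QF} (hQ : Q.disc = D) (hQ' : Q'.disc = D) (ha : 0 < Q.a)
    (ha' : 0 < Q'.a) (h : omegaQ D Q = omegaQ D Q') : Q = Q' := by
  have e1 := omega_eq (D := D) ha.ne'
  have e2 := omega_eq (D := D) ha'.ne'
  rw [h] at e1
  have hs := sqrtD_im hD
  have i1 := congrArg Complex.im e1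
  have i2 := congrArg Complex.im e2
  simp at i1 i2
  have hw : (omegaQ D Q').im ≠ 0 := by
    intro h0
    rw [h0] at i1
    simp at i1
    linarith
  have haa : Q.a = Q'.a := by
    rw [← i2] at i1
    have := mul_right_cancel₀ hw i1
    have h3 : (Q.a : ℝ) = Q'.a := by linarith
    exact_mod_cast h3
  have hbb : Q.b = Q'.b := by
    rw [haa, e2] at e1
    have : (Q.b : ℂ) = Q'.b := by linear_combination e1
    exact_mod_cast this
  have hcc : Q.c = Q'.c := by
    unfold QF.disc at hQ hQ'
    rw [haa, hbb, ← hQ'] at hQ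
    have : Q'.a * Q.c = Q'.a * Q'.c := by linarith
    exact mul_left_cancel₀ ha'.ne' this
  cases Q; cases Q'; simp_all

lemma SL_eta (γ : SL2Z) : ∃ p q r s : ℤ, (γ : Matrix (Fin 2) (Fin 2) ℤ) = !![p, q; r, s] ∧
    p * s - q * r = 1 := by
  refine ⟨γ.1 0 0, γ.1 0 1, γ.1 1 0, γ.1 1 1, Matrix.eta_fin_two _, ?_⟩
  have := γ.2
  rwa [Matrix.det_fin_two] at this

lemma inv_mod {a : ℤ} {N : ℕ} (hN : 0 < N) (h : Int.gcd a N = 1) :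
    ∃ k w : ℤ, k ≠ 0 ∧ a * k = 1 + N * w := by
  have hc := Int.gcd_eq_gcd_ab a N
  rw [h] at hc
  by_cases hk : a.gcdA N = 0
  · refine ⟨N, a - a.gcdB N, by exact_mod_cast hN.ne', ?_⟩
    rw [hk] at hc
    push_cast at hc
    linear_combination -hc
  · refine ⟨a.gcdA N, -a.gcdB N, hk, ?_⟩
    push_cast at hc
    linear_combination -hc

lemma welldef_part (hD : D < 0) (hD4 : D % 4 = 0 ∨ D % 4 = 1) {N : ℕ} (hN : 0 < N) {Q Q' : QF}
    (hQ : IsFormN D N Q) (hQ' : IsFormN D N Q') (hE : EquivG1 N Q Q')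
    (u u' : (Frac (OD D))ˣ)
    (hu : fracSet u = latticeSet (omegaQ D Q)) (hu' : fracSet u' = latticeSet (omegaQ D Q')) :
    u⁻¹ * u' ∈ Pgrp (OD D) N := by
  obtain ⟨γ, ⟨g1, g2, g3⟩, hact⟩ := hE
  obtain ⟨p, q, r, s, hγ, hdet⟩ := SL_eta γ
  rw [hγ] at g1 g2 g3 hact
  simp at g1 g2 g3
  have hA := omega_act hD hD4 hQ.1 hdet (by rw [hact]; exact hQ'.1.2.2.ne')
  rw [hact] at hA
  obtain ⟨t, e, h1, h2⟩ := tau_spec hD4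
  obtain ⟨him, hq, -⟩ := form_spec hD h1 h2 hQ.1
  obtain ⟨him', hq', -⟩ := form_spec hD h1 h2 hQ'.1
  have hmem := fun x => mem_OD' hD hD4 hQ'.1 (x := x)
  have hdet' : (p : ℂ) * s - q * r = 1 := by exact_mod_cast hdet
  have ha0 : Q'.a ≠ 0 := hQ'.1.2.2.ne'
  set ω := omegaQ D Q
  set ω' := omegaQ D Q'
  have hj : (r : ℂ) * ω' + s ≠ 0 := by
    intro h0
    have h0' : (r : ℂ) * ω' + s = ((0 : ℤ) : ℂ) * ω' + ((0 : ℤ) : ℂ) := by rw [h0]; simp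
    obtain ⟨hr, hs⟩ := indep him'.ne' h0'
    rw [hr, hs] at hdet
    simp at hdet
  have hB : ω * (r * ω' + s) = p * ω' + q := by linear_combination -hA
  obtain ⟨k, w, hk, hw⟩ := inv_mod hN hQ'.2
  obtain ⟨r1, rfl⟩ := g2
  obtain ⟨s1, hs1⟩ := g3
  have hth : (Q'.a : ℂ) * ω' ∈ OD D := (hmem _).2 ⟨1, 0, by simp⟩
  let θ : OD D := ⟨(Q'.a : ℂ) * ω', hth⟩
  have hθc : (θ : ℂ) = Q'.a * ω' := rfl
  let ν₂ : OD D := ((Q'.a * k : ℤ) : OD D)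
  let ν₁ : OD D := 1 + (N : OD D) * ((k : OD D) * r1 * θ + w + Q'.a * k * s1)
  have hv2 : (ν₂ : ℂ) = Q'.a * k := by simp [ν₂]
  have hs1' : (s : ℂ) = 1 + N * s1 := by
    have : s = 1 + N * s1 := by linarith
    exact_mod_cast this
  have hw' : (Q'.a : ℂ) * k = 1 + N * w := by exact_mod_cast hw
  have hv1 : (ν₁ : ℂ) = ν₂ * (((N * r1 : ℤ) : ℂ) * ω' + s) := by
    rw [hv2]
    simp only [ν₁]
    push_cast
    rw [hθc, hs1']
    linear_combination -hw'
  have hν₂ : ν₂ ≠ 0 := by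
    intro h0
    rw [h0] at hv2
    have : (Q'.a : ℂ) * k ≠ 0 := by exact_mod_cast mul_ne_zero ha0 hk
    exact this hv2.symm
  have hν₁ : ν₁ ≠ 0 := by
    intro h0
    rw [h0] at hv1
    exact mul_ne_zero (fr_inj hν₂) hj hv1.symm
  have c2 : cong1 N ν₂ := ⟨w, by simp only [ν₂]; rw [hw]; push_cast; ring⟩
  have c1 : cong1 N ν₁ := ⟨_, rfl⟩
  have key : pu ν₁ hν₁ * u = pu ν₂ hν₂ * u' := by
    apply fr_ext
    ext z
    rw [pu_mul_mem, pu_mul_mem, hu, hu', hv1]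
    constructor
    · rintro ⟨_, ⟨m, n, rfl⟩, rfl⟩
      refine ⟨_, ⟨m * p + n * (N * r1), m * q + n * s, rfl⟩, ?_⟩
      push_cast at hB ⊢
      linear_combination (ν₂ : ℂ) * m * hB
    · rintro ⟨_, ⟨m, n, rfl⟩, rfl⟩
      refine ⟨_, ⟨m * s - n * (N * r1), -m * q + n * p, rfl⟩, ?_⟩
      push_cast at hB hdet' ⊢
      linear_combination (-(ν₂ : ℂ)) * (m * s - n * (N * r1)) * hB
        - (ν₂ : ℂ) * (m * ω' + n) * hdet'
  have : u⁻¹ * u' = pu ν₁ hν₁ * (pu ν₂ hν₂)⁻¹ := by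
    rw [inv_mul_eq_iff_eq_mul, ← mul_assoc, eq_mul_inv_iff_mul_eq, mul_comm u', ← key, mul_comm]
  rw [this]
  exact mul_mem (pu_mem_P _ c1) (inv_mem (pu_mem_P _ c2))

lemma inj_part (hD : D < 0) (hD4 : D % 4 = 0 ∨ D % 4 = 1) {N : ℕ} {Q Q' : QF}
    (hQ : IsFormN D N Q) (hQ' : IsFormN D N Q')
    (u u' : (Frac (OD D))ˣ)
    (hu : fracSet u = latticeSet (omegaQ D Q)) (hu' : fracSet u' = latticeSet (omegaQ D Q'))
    (hP : u⁻¹ * u' ∈ Pgrp (OD D) N) : EquivG1 N Q Q' := by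
  obtain ⟨ν, μ, hν, hμ, ⟨α, hα⟩, ⟨β, hβ⟩, hE⟩ := P_elim hP
  have hE : pu μ hμ * u' = pu ν hν * u := by
    rw [mul_assoc, inv_mul_eq_iff_eq_mul] at hE
    rw [mul_comm, hE, mul_comm]
  obtain ⟨t, e, h1, h2⟩ := tau_spec hD4
  obtain ⟨him, hq, -⟩ := form_spec hD h1 h2 hQ.1
  obtain ⟨him', hq', -⟩ := form_spec hD h1 h2 hQ'.1
  have hmem := fun x => mem_OD' hD hD4 hQ'.1 (x := x)
  have ha0 : Q'.a ≠ 0 := hQ'.1.2.2.ne'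
  have hOA := fun p q r s h => omega_act hD hD4 hQ.1 (p := p) (q := q) (r := r) (s := s) h
    (act_pos hD hQ.1 h).ne'
  have hFU := fun p q r s (h : p * s - q * r = 1) => form_uniq hD (Q := Q.act !![p, q; r, s])
    (Q' := Q') ((act_disc h).trans hQ.1.2.1) hQ'.1.2.1 (act_pos hD hQ.1 h) hQ'.1.2.2
  set ω := omegaQ D Q
  set ω' := omegaQ D Q'
  have hνc := fr_inj hν
  have hμc := fr_inj hμ
  have F : ∀ y ∈ latticeSet ω, ∃ y' ∈ latticeSet ω', (ν : ℂ) * y = μ * y' := by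
    intro y hy
    have : (ν : ℂ) * y ∈ fracSet (pu μ hμ * u') := by
      rw [hE, pu_mul_mem, hu]; exact ⟨y, hy, rfl⟩
    rw [pu_mul_mem, hu'] at this
    exact this
  have G : ∀ y ∈ latticeSet ω', ∃ y' ∈ latticeSet ω, (μ : ℂ) * y = ν * y' := by
    intro y hy
    have : (μ : ℂ) * y ∈ fracSet (pu ν hν * u) := by
      rw [← hE, pu_mul_mem, hu']; exact ⟨y, hy, rfl⟩
    rw [pu_mul_mem, hu] at this
    exact this
  obtain ⟨_, ⟨p, q, rfl⟩, hp⟩ := F ω ⟨1, 0, by simp⟩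
  obtain ⟨_, ⟨r, s, rfl⟩, hr⟩ := F 1 ⟨0, 1, by simp⟩
  obtain ⟨_, ⟨m, n, rfl⟩, hm⟩ := G ω' ⟨1, 0, by simp⟩
  obtain ⟨_, ⟨m', n', rfl⟩, hm'⟩ := G 1 ⟨0, 1, by simp⟩
  have i1 : p * m + q * m' = 1 ∧ p * n + q * n' = 0 := by
    apply indep him.ne'
    apply mul_left_cancel₀ hνc
    push_cast
    linear_combination -hp - (p : ℂ) * hm - (q : ℂ) * hm'
  have i2 : r * m + s * m' = 0 ∧ r * n + s * n' = 1 := by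
    apply indep him.ne'
    apply mul_left_cancel₀ hνc
    push_cast
    linear_combination -hr - (r : ℂ) * hm - (s : ℂ) * hm'
  have hdd : (p * s - q * r) * (m * n' - n * m') = 1 := by
    linear_combination (r * n + s * n') * i1.1 + i2.2 - (r * m + s * m') * i1.2
  have hB : ω * (r * ω' + s) = p * ω' + q := by
    apply mul_left_cancel₀ hμc
    linear_combination hp - ω * hr
  have hdet : p * s - q * r = 1 := by
    rcases Int.isUnit_iff.1 (IsUnit.of_mul_eq_one _ hdd) with h | h
    · exact h
    · exfalso
      have hre := congrArg Complex.re hB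
      have him2 := congrArg Complex.im hB
      simp at hre him2
      have hR : (p : ℝ) * s - q * r = -1 := by exact_mod_cast h
      have : ω.im * ((r * ω'.re + s) ^ 2 + (r * ω'.im) ^ 2) = -ω'.im := by
        linear_combination (r * ω'.re + s) * him2 - (r * ω'.im) * hre + ω'.im * hR
      nlinarith [mul_nonneg him.le (add_nonneg (sq_nonneg (r * ω'.re + s)) (sq_nonneg (r * ω'.im)))]
  have hth : (Q'.a : ℂ) * ω' ∈ OD D := (hmem _).2 ⟨1, 0, by simp⟩
  have hX : (Q'.a : ℂ) * α - β * (r * (Q'.a * ω') + s * Q'.a) ∈ OD D := by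
    refine sub_mem (mul_mem (intCast_mem _ _) α.2) (mul_mem β.2 (add_mem
      (mul_mem (intCast_mem _ _) hth) (mul_mem (intCast_mem _ _) (intCast_mem _ _))))
  obtain ⟨x, y, hxy⟩ := (hmem _).1 hX
  have hαc : (ν : ℂ) = 1 + N * α := by rw [hα]; push_cast; rfl
  have hβc : (μ : ℂ) = 1 + N * β := by rw [hβ]; push_cast; rfl
  have hfin : r * Q'.a = N * x * Q'.a ∧ Q'.a * (s - 1) = N * y := by
    apply indep him'.ne'
    push_cast
    rw [hαc, hβc] at hr
    linear_combination N * hxy - Q'.a * hr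
  have hr' : r = N * x := mul_right_cancel₀ ha0 hfin.1
  have hs' : (N : ℤ) ∣ s - 1 := by
    have : IsCoprime (N : ℤ) Q'.a := (Int.isCoprime_iff_gcd_eq_one.2 hQ'.2).symm
    exact this.dvd_of_dvd_mul_left ⟨y, hfin.2⟩
  have hr'' : (N : ℤ) ∣ r := ⟨x, hr'⟩
  refine ⟨⟨!![p, q; r, s], by rw [Matrix.det_fin_two]; simpa using hdet⟩, ⟨?_, ?_, ?_⟩, ?_⟩
  · have : p - 1 = q * r - p * (s - 1) := by linear_combination hdet
    simp only [Matrix.of_apply, Matrix.cons_val', Matrix.cons_val_zero]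
    rw [this]
    exact dvd_sub (hr''.mul_left _) (hs'.mul_left _)
  · simpa using hr''
  · simpa using hs'
  · apply hFU p q r s hdet
    have h3 := hOA p q r s hdet
    have hne : (p : ℂ) - r * ω ≠ 0 := by
      intro h0
      have h0' : ((-r : ℤ) : ℂ) * ω + p = ((0 : ℤ) : ℂ) * ω + ((0 : ℤ) : ℂ) := by
        push_cast; linear_combination h0
      obtain ⟨hr, hs⟩ := indep him.ne' h0'
      rw [hs, neg_eq_zero.1 hr] at hdet
      simp at hdet
    apply mul_right_cancel₀ hne
    rw [h3]
    linear_combination hB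
end part3
section part4
variable {D : ℤ}

lemma coprime_lift {N : ℕ} (hN : 0 < N) {x y : ℤ}
    (h : ∀ d : ℤ, d ∣ x → d ∣ y → d ∣ (N : ℤ) → IsUnit d) :
    ∃ i j : ℤ, IsCoprime (x + N * i) (y + N * j) := by
  obtain ⟨j, hj⟩ : ∃ j : ℤ, y + N * j ≠ 0 := by
    by_cases hy : y = 0
    · exact ⟨1, by rw [hy]; simp; omega⟩
    · exact ⟨0, by simpa using hy⟩
  set y' := y + N * j with hy'
  let m : ℕ := y'.natAbs
  haveI : NeZero m := ⟨Int.natAbs_ne_zero.2 hj⟩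
  let g : ℕ := Nat.gcd N m
  have hgN : (g : ℤ) ∣ N := Int.natCast_dvd_natCast.2 (Nat.gcd_dvd_left N m)
  have hgm : g ∣ m := Nat.gcd_dvd_right N m
  have hgy : (g : ℤ) ∣ y' := by
    rw [← Int.dvd_natAbs]; exact Int.natCast_dvd_natCast.2 hgm
  have hc : IsCoprime (g : ℤ) x := by
    rw [Int.isCoprime_iff_gcd_eq_one]
    have hd1 : ((Int.gcd g x : ℕ) : ℤ) ∣ g := Int.gcd_dvd_left _ _
    have hd2 : ((Int.gcd g x : ℕ) : ℤ) ∣ x := Int.gcd_dvd_right _ _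
    have hu := h _ hd2 (by
      have h1 := hd1.trans hgy
      have h2 := (hd1.trans hgN).mul_right j
      have : y = y' - N * j := by rw [hy']; ring
      rw [this]; exact dvd_sub h1 h2) (hd1.trans hgN)
    simpa using Int.isUnit_iff_natAbs_eq.1 hu
  have hxu := (ZMod.coe_int_isUnit_iff_isCoprime x g).2 hc
  obtain ⟨v, hv⟩ := ZMod.unitsMap_surjective hgm hxu.unit
  obtain ⟨X, hX⟩ := ZMod.intCast_surjective (v : ZMod m)
  have hXm : IsCoprime (m : ℤ) X := by
    rw [← ZMod.coe_int_isUnit_iff_isCoprime, hX]; exact v.isUnit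
  have hXg : (X : ZMod g) = (x : ZMod g) := by
    have h1 := congrArg (Units.val) hv
    rw [ZMod.unitsMap_val, ← hX] at h1
    simpa [ZMod.cast_intCast hgm] using h1
  obtain ⟨k, hk⟩ := (ZMod.intCast_eq_intCast_iff_dvd_sub x X g).1 hXg.symm
  have hbez := Nat.gcd_eq_gcd_ab N m
  refine ⟨Nat.gcdA N m * k, j, ?_⟩
  rw [← hy']
  have e1 : x + N * (Nat.gcdA N m * k) = X + m * (-(Nat.gcdB N m * k)) := by
    have : (g : ℤ) = N * Nat.gcdA N m + m * Nat.gcdB N m := hbez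
    rw [this] at hk
    linear_combination -hk
  rw [e1]
  have h2 : IsCoprime (X + m * (-(Nat.gcdB N m * k))) (m : ℤ) := by
    have := hXm.symm.add_mul_left_left (-(Nat.gcdB N m * k))
    exact this
  have h3 : (m : ℤ) ∣ y' := Int.natAbs_dvd.2 dvd_rfl
  exact h2.of_isCoprime_of_dvd_right (Int.dvd_natAbs.2 dvd_rfl)

lemma two_gen (hD : D < 0) (hD4 : D % 4 = 0 ∨ D % 4 = 1) {A : Ideal (OD D)} (hA : A ≠ 0) :
    ∃ α ∈ A, ∃ β ∈ A, (∀ z ∈ A, ∃ x y : ℤ, z = x * α + y * β) ∧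
      ∀ x y : ℤ, (x : OD D) * α + y * β = 0 → x = 0 ∧ y = 0 := by
  obtain ⟨t, e, h1, h2⟩ := tau_spec hD4
  have htau := tau_sq hD h1 h2
  have him := tau_im hD h1
  have hmem := fun x => mem_OD hD hD4 (x := x)
  let τ : OD D := ⟨tauD D, (hmem _).2 ⟨1, 0, by simp⟩⟩
  have hτ : (τ : ℂ) = tauD D := rfl
  have hO : ∀ z : OD D, ∃ m n : ℤ, z = m * τ + n := by
    intro z
    obtain ⟨m, n, h⟩ := (hmem z).1 z.2
    exact ⟨m, n, Subtype.ext (by push_cast; rw [h])⟩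
  have hind : ∀ m n : ℤ, (m : OD D) * τ + n = 0 → m = 0 ∧ n = 0 := by
    intro m n h
    have h' := congrArg Subtype.val h
    push_cast at h'
    apply indep him.ne'
    rw [← hτ, h']; simp
  have hτ2 : τ * τ = t * τ + e := by
    apply Subtype.ext
    push_cast
    rw [hτ, ← htau]; ring
  let G : AddSubgroup ℤ :=
    { carrier := {m | ∃ n : ℤ, (m : OD D) * τ + n ∈ A}
      zero_mem' := ⟨0, by simp⟩
      add_mem' := by
        rintro a b ⟨n, hn⟩ ⟨n', hn'⟩
        refine ⟨n + n', ?_⟩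
        have := add_mem hn hn'
        convert this using 1
        push_cast; ring
      neg_mem' := by
        rintro a ⟨n, hn⟩
        refine ⟨-n, ?_⟩
        have := neg_mem hn
        convert this using 1
        push_cast; ring }
  let H : AddSubgroup ℤ :=
    { carrier := {n | (n : OD D) ∈ A}
      zero_mem' := by simp
      add_mem' := by
        intro a b ha hb
        have := add_mem (S := Ideal (OD D)) ha hb
        simpa using this
      neg_mem' := by
        intro a ha
        have := neg_mem (S := Ideal (OD D)) ha
        simpa using this }
  obtain ⟨g, hg⟩ := Int.subgroup_cyclic G
  obtain ⟨h, hh⟩ := Int.subgroup_cyclic H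
  have hgG : g ∈ G := by rw [hg]; exact AddSubgroup.subset_closure rfl
  have hhH : h ∈ H := by rw [hh]; exact AddSubgroup.subset_closure rfl
  obtain ⟨n0, hn0⟩ := hgG
  have hG : ∀ m ∈ G, ∃ x : ℤ, m = x * g := by
    intro m hm
    rw [hg, AddSubgroup.mem_closure_singleton] at hm
    obtain ⟨x, rfl⟩ := hm
    exact ⟨x, by simp⟩
  have hH : ∀ m ∈ H, ∃ x : ℤ, m = x * h := by
    intro m hm
    rw [hh, AddSubgroup.mem_closure_singleton] at hm
    obtain ⟨x, rfl⟩ := hm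
    exact ⟨x, by simp⟩
  have hg0 : g ≠ 0 := by
    intro hg0
    obtain ⟨z, hz, hz0⟩ := Submodule.exists_mem_ne_zero_of_ne_bot hA
    obtain ⟨m, n, rfl⟩ := hO z
    obtain ⟨x, hx⟩ := hG m ⟨n, hz⟩
    rw [hg0, mul_zero] at hx
    subst hx
    have hτz : (n : OD D) * τ + ((0 : ℤ) : OD D) ∈ A := by
      have := A.mul_mem_left τ hz
      convert this using 1
      push_cast; ring
    obtain ⟨x, hx⟩ := hG n ⟨0, hτz⟩
    rw [hg0, mul_zero] at hx
    subst hx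
    simp at hz0
  have hα0 : (g : OD D) * τ + n0 ≠ 0 := fun h' => hg0 (hind _ _ h').1
  have hh0 : h ≠ 0 := by
    intro hh0
    have hmemN : ((-e * g ^ 2 + g * n0 * t + n0 ^ 2 : ℤ) : OD D) ∈ A := by
      have := A.mul_mem_left ((-g : ℤ) * τ + ((g * t + n0 : ℤ) : OD D)) hn0
      convert this using 1
      push_cast
      linear_combination (g : OD D) ^ 2 * hτ2
    obtain ⟨x, hx⟩ := hH _ hmemN
    rw [hh0, mul_zero] at hx
    have hz : ((-g : ℤ) * τ + ((g * t + n0 : ℤ) : OD D)) * ((g : OD D) * τ + n0) = 0 := by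
      have hx' := congrArg (Int.cast : ℤ → OD D) hx
      push_cast at hx' ⊢
      linear_combination hx' - (g : OD D) ^ 2 * hτ2
    rcases mul_eq_zero.1 hz with h' | h'
    · exact hg0 (by have := (hind _ _ h').1; omega)
    · exact hα0 h'
  refine ⟨_, hn0, (h : OD D), hhH, ?_, ?_⟩
  · intro z hz
    obtain ⟨m, n, rfl⟩ := hO z
    obtain ⟨x, rfl⟩ := hG m ⟨n, hz⟩
    have : ((n - x * n0 : ℤ) : OD D) ∈ A := by
      have := sub_mem hz (A.mul_mem_left (x : OD D) hn0)
      convert this using 1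
      push_cast; ring
    obtain ⟨y, hy⟩ := hH _ this
    refine ⟨x, y, ?_⟩
    have hy' := congrArg (Int.cast : ℤ → OD D) hy
    push_cast at hy' ⊢
    linear_combination hy'
  · intro x y hxy
    have := hind (x * g) (x * n0 + y * h) (by push_cast; linear_combination hxy)
    have hx : x = 0 := (mul_eq_zero.1 this.1).resolve_right hg0
    refine ⟨hx, ?_⟩
    have h3 := this.2
    rw [hx] at h3
    simp at h3
    exact h3.resolve_right hh0

lemma lattice_form (hD : D < 0) (hD4 : D % 4 = 0 ∨ D % 4 = 1) (u : (Frac (OD D))ˣ) {ω : ℂ}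
    (hω : 0 < ω.im) (hu : fracSet u = latticeSet ω) : ∃ Q, IsForm D Q ∧ ω = omegaQ D Q := by
  obtain ⟨t, e, h1, h2⟩ := tau_spec hD4
  have htau := tau_sq hD h1 h2
  have him := tau_im hD h1
  have hmem := fun x => mem_OD hD hD4 (x := x)
  have hτO : tauD D ∈ OD D := (hmem _).2 ⟨1, 0, by simp⟩
  have hL : ∀ z ∈ latticeSet ω, tauD D * z ∈ latticeSet ω := by
    intro z hz
    rw [← hu] at hz ⊢
    exact fr_smul _ hτO hz
  obtain ⟨k, l, hk⟩ := hL 1 ⟨0, 1, by simp⟩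
  obtain ⟨m, n, hm⟩ := hL ω ⟨1, 0, by simp⟩
  rw [mul_one] at hk
  have hkpos : 0 < k := by
    have h3 := congrArg Complex.im hk
    simp at h3
    rw [h3] at him
    have := pos_of_mul_pos_left him hω.le
    exact_mod_cast this
  have hte : t = m + l ∧ e = k * n - m * l := by
    apply indep him.ne'
    rw [← htau]
    push_cast
    linear_combination (tauD D - m) * hk + k * hm
  have hkC : (k : ℂ) ≠ 0 := by exact_mod_cast hkpos.ne'
  refine ⟨⟨k, l - m, -n⟩, ⟨?_, ?_, hkpos⟩, ?_⟩
  · set g := Int.gcd k (Int.gcd (l - m) (-n)) with hg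
    have d1 : (g : ℤ) ∣ k := Int.gcd_dvd_left _ _
    have d0 : (g : ℤ) ∣ (Int.gcd (l - m) (-n) : ℤ) := Int.gcd_dvd_right _ _
    have d2 : (g : ℤ) ∣ l - m := d0.trans (Int.gcd_dvd_left _ _)
    have d3 : (g : ℤ) ∣ -n := d0.trans (Int.gcd_dvd_right _ _)
    have hg0 : (g : ℤ) ≠ 0 := by
      intro h0
      rw [h0] at d1
      exact hkpos.ne' (zero_dvd_iff.1 d1)
    obtain ⟨k1, hk1⟩ := d1
    obtain ⟨m1, hm1⟩ := d2
    obtain ⟨n1, hn1⟩ := d3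
    have hgC : (g : ℂ) ≠ 0 := by exact_mod_cast hg0
    have hk1' : (k : ℂ) = g * k1 := by exact_mod_cast hk1
    have hm1' : (l : ℂ) - m = g * m1 := by exact_mod_cast hm1
    have hn1' : -(n : ℂ) = g * n1 := by exact_mod_cast hn1
    have hx : (tauD D - l) / g ∈ OD D := by
      apply fr_proper u
      rw [hu]
      rintro _ ⟨c, d, rfl⟩
      refine ⟨-c * m1 + d * k1, -c * n1, ?_⟩
      rw [div_mul_eq_mul_div, div_eq_iff hgC]
      push_cast
      linear_combination c * hm + d * hk - c * ω * hm1' - c * hn1' + d * ω * hk1'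
    obtain ⟨a, b, hab⟩ := (hmem _).1 hx
    rw [div_eq_iff hgC] at hab
    have : (1 : ℤ) = a * g ∧ -l = b * g := by
      apply indep him.ne'
      push_cast
      linear_combination hab
    have hgu : IsUnit (g : ℤ) := IsUnit.of_mul_eq_one a (by linarith [this.1])
    simpa using Int.isUnit_iff_natAbs_eq.1 hgu
  · unfold QF.disc
    simp only
    rw [h2, hte.1, hte.2]; ring
  · unfold omegaQ
    simp only
    rw [eq_div_iff (by simpa using hkC)]
    have ht : (t : ℂ) = m + l := by exact_mod_cast hte.1
    push_cast
    linear_combination -2 * hk + h1 + ht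

lemma surj_part (hD : D < 0) (hD4 : D % 4 = 0 ∨ D % 4 = 1) {N : ℕ} (hN : 0 < N)
    (w : (Frac (OD D))ˣ) (hw : w ∈ Igrp (OD D) N) :
    ∃ (Q : QF) (_ : IsFormN D N Q) (u : (Frac (OD D))ˣ) (_ : u ∈ Igrp (OD D) N),
      fracSet u = latticeSet (omegaQ D Q) ∧ u⁻¹ * w ∈ Pgrp (OD D) N := by
  obtain ⟨A, hA, v, hv, hvP⟩ := I_elim hN hw
  obtain ⟨ν₀, hν₀A, -, ⟨η, hη⟩⟩ := exists_cong1 hN hA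
  obtain ⟨α, hα, β, hβ, hgen, hind⟩ := two_gen hD hD4 hA.1
  obtain ⟨x, y, hxy⟩ := hgen _ hν₀A
  obtain ⟨t, e, h1, h2⟩ := tau_spec hD4
  have him := tau_im hD h1
  have hmem := fun x => mem_OD hD hD4 (x := x)
  have hτO : tauD D ∈ OD D := (hmem _).2 ⟨1, 0, by simp⟩
  obtain ⟨i, j, hij⟩ := coprime_lift hN (x := x) (y := y) (by
    rintro d ⟨x1, rfl⟩ ⟨y1, rfl⟩ ⟨N1, hN1⟩
    have hN1' : (N : OD D) = d * N1 := by exact_mod_cast congrArg (Int.cast : ℤ → OD D) hN1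
    let W : OD D := x1 * α + y1 * β - N1 * η
    have hW : (1 : OD D) = d * W := by
      simp only [W]
      rw [hxy, hN1'] at hη
      push_cast at hη
      linear_combination -hη
    obtain ⟨m, n, hmn⟩ := (hmem W).1 W.2
    have hW' := congrArg Subtype.val hW
    push_cast at hW'
    rw [hmn] at hW'
    have : (0 : ℤ) = d * m ∧ (1 : ℤ) = d * n := by
      apply indep him.ne'
      push_cast
      linear_combination hW'
    exact IsUnit.of_mul_eq_one n this.2.symm)
  set X := x + N * i with hX
  set Y := y + N * j with hY
  obtain ⟨a, b, hab⟩ := hij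
  have habO : (a : OD D) * X + b * Y = 1 := by exact_mod_cast congrArg (Int.cast : ℤ → OD D) hab
  let ν : OD D := X * α + Y * β
  have hνA : ν ∈ A := add_mem (A.mul_mem_left _ hα) (A.mul_mem_left _ hβ)
  have cν : cong1 N ν := ⟨η + i * α + j * β, by
    simp only [ν, hX, hY]
    rw [hxy] at hη
    push_cast
    linear_combination hη⟩
  have hν : ν ≠ 0 := by
    intro h0
    obtain ⟨hx0, hy0⟩ := hind _ _ h0
    rw [hx0, hy0] at hab
    simp at hab
  have hνc := fr_inj hν
  let δ : OD D := -b * α + a * β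
  have hδA : δ ∈ A := add_mem (A.mul_mem_left _ hα) (A.mul_mem_left _ hβ)
  have hgen' : ∀ z ∈ A, ∃ c d : ℤ, z = c * δ + d * ν := by
    intro z hz
    obtain ⟨c, d, rfl⟩ := hgen z hz
    refine ⟨-c * Y + d * X, c * a + d * b, ?_⟩
    simp only [δ, ν]
    push_cast
    linear_combination -(c * α + d * β) * habO
  have hset : fracSet ((pu ν hν)⁻¹ * v) = latticeSet ((δ : ℂ) / ν) := by
    ext z
    rw [pu_inv_mul_mem, fr_mem_fracSet, hv, FractionalIdeal.mem_coeIdeal]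
    constructor
    · rintro ⟨y, hy, hyz⟩
      have hyz : (y : ℂ) = ν * z := hyz
      obtain ⟨c, d, rfl⟩ := hgen' y hy
      refine ⟨c, d, ?_⟩
      apply mul_left_cancel₀ hνc
      rw [← hyz]
      push_cast
      field_simp
    · rintro ⟨c, d, rfl⟩
      refine ⟨c * δ + d * ν, add_mem (A.mul_mem_left _ hδA) (A.mul_mem_left _ hνA), ?_⟩
      change ((c * δ + d * ν : OD D) : ℂ) = _
      push_cast
      field_simp
  set u := (pu ν hν)⁻¹ * v with hu
  obtain ⟨ω, hωim, hω⟩ : ∃ ω : ℂ, 0 < ω.im ∧ fracSet u = latticeSet ω := by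
    set ω₁ := (δ : ℂ) / ν
    have h1L : (1 : ℂ) ∈ fracSet u := by rw [hset]; exact ⟨0, 1, by simp⟩
    have hτL : tauD D * 1 ∈ fracSet u := fr_smul _ hτO h1L
    rw [hset] at hτL
    obtain ⟨k, l, hk⟩ := hτL
    have hne : ω₁.im ≠ 0 := by
      intro h0
      have h3 := congrArg Complex.im hk
      simp [h0] at h3
      linarith
    rcases lt_or_gt_of_ne hne with h | h
    · refine ⟨-ω₁, by simpa using h, ?_⟩
      rw [hset]
      ext z
      constructor
      · rintro ⟨c, d, rfl⟩
        exact ⟨-c, d, by push_cast; ring⟩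
      · rintro ⟨c, d, rfl⟩
        exact ⟨-c, d, by push_cast; ring⟩
    · exact ⟨ω₁, h, hset⟩
  obtain ⟨Q, hQ, rfl⟩ := lattice_form hD hD4 u hωim hω
  have hgcd : Int.gcd Q.a N = 1 := by
    rw [← Int.isCoprime_iff_gcd_eq_one]
    have hωL : omegaQ D Q ∈ fracSet u := by rw [hω]; exact ⟨1, 0, by simp⟩
    have hνω : (ν : ℂ) * omegaQ D Q ∈ OD D := by
      have := hωL
      rw [hu, pu_inv_mul_mem, fr_mem_fracSet, hv, FractionalIdeal.mem_coeIdeal] at this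
      obtain ⟨y, -, hy⟩ := this
      rw [← hy]
      exact y.2
    obtain ⟨m, n, hmn⟩ := (mem_OD' hD hD4 hQ).1 hνω
    obtain ⟨μ, hμ⟩ := cν
    have hμω : (μ : ℂ) * omegaQ D Q ∈ fracSet u := fr_smul _ μ.2 hωL
    rw [hω] at hμω
    obtain ⟨k, l, hkl⟩ := hμω
    have hνc' : (ν : ℂ) = 1 + N * μ := by rw [hμ]; push_cast; rfl
    have : 1 + N * k = m * Q.a ∧ N * l = n := by
      apply indep hωim.ne'
      rw [hνc'] at hmn
      push_cast
      linear_combination hmn - N * hkl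
    exact ⟨m, -k, by linear_combination -this.1⟩
  have huP : u⁻¹ * w ∈ Pgrp (OD D) N := by
    have : u⁻¹ * w = pu ν hν * (w⁻¹ * v)⁻¹ := by
      rw [hu, mul_inv, inv_inv, mul_inv, inv_inv, mul_assoc, mul_comm w]
    rw [this]
    exact mul_mem (pu_mem_P _ cν) (inv_mem hvP)
  refine ⟨Q, ⟨hQ, hgcd⟩, u, ?_, hω, huP⟩
  exact mul_mem (inv_mem (P_le_I (pu_mem_P _ cν))) (M_mem_I hA v hv)
end part4

/-!
STATEMENT 1: the map `Q ↦ ℤω_Q + ℤ` induces a well-defined bijection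
`φ_{O,N} : C_N(D_O) → C_N(O)`, `[Q] ↦ [ℤω_Q + ℤ]`:
(existence) every `Q ∈ 𝒬(D_O, N)` determines an invertible fractional ideal `ℤω_Q + ℤ`
lying in `I(O, N)`;
(well-definedness) `Γ₁(N)`-equivalent forms give the same class in `C_N(O)`;
(injectivity) forms giving the same class in `C_N(O)` are `Γ₁(N)`-equivalent;
(surjectivity) every class of `C_N(O)` arises as `[ℤω_Q + ℤ]`.
-/

theorem statement1 (D : ℤ) (hD : D < 0) (hD4 : D % 4 = 0 ∨ D % 4 = 1) (N : ℕ) (hN : 0 < N) :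
    -- existence of the ideal `ℤω_Q + ℤ` as an element of `I(O, N)`:
    (∀ Q : QF, IsFormN D N Q →
      ∃ u : (Frac (OD D))ˣ, fracSet u = latticeSet (omegaQ D Q) ∧ u ∈ Igrp (OD D) N) ∧
    -- well-definedness:
    (∀ Q Q' : QF, IsFormN D N Q → IsFormN D N Q' → EquivG1 N Q Q' →
      ∀ (u u' : (Frac (OD D))ˣ)
        (hu : u ∈ Igrp (OD D) N) (hu' : u' ∈ Igrp (OD D) N),
        fracSet u = latticeSet (omegaQ D Q) → fracSet u' = latticeSet (omegaQ D Q') →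
        (QuotientGroup.mk ⟨u, hu⟩ : ClsGrp (OD D) N) = QuotientGroup.mk ⟨u', hu'⟩) ∧
    -- injectivity:
    (∀ Q Q' : QF, IsFormN D N Q → IsFormN D N Q' →
      ∀ (u u' : (Frac (OD D))ˣ)
        (hu : u ∈ Igrp (OD D) N) (hu' : u' ∈ Igrp (OD D) N),
        fracSet u = latticeSet (omegaQ D Q) → fracSet u' = latticeSet (omegaQ D Q') →
        (QuotientGroup.mk ⟨u, hu⟩ : ClsGrp (OD D) N) = QuotientGroup.mk ⟨u', hu'⟩ →
        EquivG1 N Q Q') ∧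
    -- surjectivity:
    (∀ C : ClsGrp (OD D) N, ∃ (Q : QF) (_ : IsFormN D N Q) (u : (Frac (OD D))ˣ)
        (hu : u ∈ Igrp (OD D) N),
        fracSet u = latticeSet (omegaQ D Q) ∧ QuotientGroup.mk ⟨u, hu⟩ = C) := by
  have hq : ∀ (u u' : (Frac (OD D))ˣ) (hu : u ∈ Igrp (OD D) N) (hu' : u' ∈ Igrp (OD D) N),
      (QuotientGroup.mk ⟨u, hu⟩ : ClsGrp (OD D) N) = QuotientGroup.mk ⟨u', hu'⟩ ↔
        u⁻¹ * u' ∈ Pgrp (OD D) N := by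
    intro u u' hu hu'
    rw [QuotientGroup.eq, Subgroup.mem_subgroupOf]
    rfl
  refine ⟨fun Q hQ => exist_part hD hD4 N Q hQ, ?_, ?_, ?_⟩
  · intro Q Q' hQ hQ' hE u u' hu hu' h h'
    rw [hq]
    exact welldef_part hD hD4 hN hQ hQ' hE u u' h h'
  · intro Q Q' hQ hQ' u u' hu hu' h h' hc
    rw [hq] at hc
    exact inj_part hD hD4 hQ hQ' u u' h h' hc
  · intro C
    obtain ⟨⟨w, hw⟩, rfl⟩ := QuotientGroup.mk_surjective C
    obtain ⟨Q, hQ, u, hu, h, hP⟩ := surj_part hD hD4 hN w hw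
    exact ⟨Q, hQ, u, hu, h, (hq _ _ _ _).2 hP⟩
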